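/- Let O be an index set of observation points and, for each j ∈ O, let R_j ⊆ Σ × Σ be the j-th reachability relation of the program, with post_j(X) := {t | ∃ s ∈ X, R_j s t} and p̃re_j(X) := {s | ∀ t, R_j s t → t ∈ X}. Then trace-based non-interference holds — ∀ j ∈ O, ∀ s₁ s₂ : Σ, s₁° = s₂° → (post_j {s₁})° = (post_j {s₂})° — if and only if for every j ∈ O the abstraction 𝓗 is forward complete for the weakest-precondition map, i.e., ∀ j ∈ O, ∀ X : Set Σ, 𝓗(p̃re_j(𝓗 X)) = p̃re_j(𝓗 X). -/

import Mathlib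

/-- The abstraction `𝓗` pairing each observable value occurring in `X`
with all internal values. -/
def HH {H L : Type*} (X : Set (H × L)) : Set (H × L) :=
  Set.univ ×ˢ (Prod.snd '' X)

/-- The strongest-postcondition map of a relation `R`. -/
def post {σ : Type*} (R : σ → σ → Prop) (X : Set σ) : Set σ :=
  {t | ∃ s ∈ X, R s t}

/-- The weakest-precondition map of a relation `R`. -/
def pre {σ : Type*} (R : σ → σ → Prop) (X : Set σ) : Set σ :=
  {s | ∀ t, R s t → t ∈ X}

theorem mem_HH {H L : Type*} {X : Set (H × L)} {s : H × L} :
    s ∈ HH X ↔ s.2 ∈ Prod.snd '' X := by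
  simp [HH]

/-- The weakest precondition of `𝓗 X` consists of the states whose observable
outcomes all occur in `X`. -/
theorem mem_pre_HH {H L : Type*} {R : (H × L) → (H × L) → Prop}
    {X : Set (H × L)} {s : H × L} :
    s ∈ pre R (HH X) ↔ Prod.snd '' post R {s} ⊆ Prod.snd '' X := by
  simp only [Set.image_subset_iff, post, Set.mem_singleton_iff, exists_eq_left]
  exact forall₂_congr fun _ _ => mem_HH

/-- Trace-based non-interference w.r.t. a family of reachability relations
indexed by observation points holds iff `𝓗` is forward complete for every
weakest-precondition map `p̃re_j`, `j ∈ O`. -/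
theorem trace_ni_iff_forward_complete_pre {H L J : Type*} (O : Set J)
    (R : J → (H × L) → (H × L) → Prop) :
    (∀ j ∈ O, ∀ s₁ s₂ : H × L, s₁.2 = s₂.2 →
        Prod.snd '' post (R j) ({s₁} : Set (H × L)) =
          Prod.snd '' post (R j) ({s₂} : Set (H × L))) ↔
      (∀ j ∈ O, ∀ X : Set (H × L),
        HH (pre (R j) (HH X)) = pre (R j) (HH X)) := by
  refine forall₂_congr fun j _ => ⟨fun h X => ?_, fun h => ?_⟩
  · ext s
    rw [mem_HH]
    refine ⟨?_, Set.mem_image_of_mem _⟩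
    rintro ⟨s', hs', hobs⟩
    rw [mem_pre_HH] at hs' ⊢
    rwa [← h s' s hobs]
  · have post_subset (s₁ s₂ : H × L) (hobs : s₁.2 = s₂.2) :
        Prod.snd '' post (R j) {s₁} ⊆ Prod.snd '' post (R j) {s₂} := by
      rw [← mem_pre_HH, ← h, mem_HH]
      exact ⟨s₂, mem_pre_HH.2 subset_rfl, hobs.symm⟩
    exact fun s₁ s₂ hobs =>
      (post_subset s₁ s₂ hobs).antisymm (post_subset s₂ s₁ hobs.symm)
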